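/- In the normalized local setup at the origin, for the matrix H^{ab̄} = h u_a conj(u_b) + h g^{pq̄}(∂_p u_a + u_a h^{-1}∂_p h)·conj(∂_q u_b + u_b h^{-1}∂_q h) (u_0 = 1, u_i = z^i), one has (∂_k ∂_l̄ H^{ab̄})(0) = 0 whenever a = 0 or b = 0, for all 1 ≤ k,l ≤ n. -/

import Mathlib

noncomputable section
open Complex Matrix
open scoped ComplexOrder

/-- The Wirtinger derivative `∂ₖ f = (1/2)(∂f/∂xᵏ − i ∂f/∂yᵏ)` of a complex-valued
function on `ℂⁿ` (with its Euclidean structure), where `zᵏ = xᵏ + i yᵏ`. -/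
def wd {n : ℕ} (k : Fin n) (f : EuclideanSpace ℂ (Fin n) → ℂ)
    (z : EuclideanSpace ℂ (Fin n)) : ℂ :=
  (1/2 : ℂ) * (fderiv ℝ f z (EuclideanSpace.single k 1)
    - Complex.I * fderiv ℝ f z (EuclideanSpace.single k Complex.I))

/-- The conjugate Wirtinger derivative `∂ₖ̄ f = (1/2)(∂f/∂xᵏ + i ∂f/∂yᵏ)`. -/
def wdb {n : ℕ} (k : Fin n) (f : EuclideanSpace ℂ (Fin n) → ℂ)
    (z : EuclideanSpace ℂ (Fin n)) : ℂ :=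
  (1/2 : ℂ) * (fderiv ℝ f z (EuclideanSpace.single k 1)
    + Complex.I * fderiv ℝ f z (EuclideanSpace.single k Complex.I))

/-- The inverse transpose matrix `(g^{ij̄})` of a matrix-valued function `(g_{ij̄})`. -/
def ginv {n : ℕ} (g : Fin n → Fin n → EuclideanSpace ℂ (Fin n) → ℂ)
    (z : EuclideanSpace ℂ (Fin n)) : Matrix (Fin n) (Fin n) ℂ :=
  ((Matrix.of fun i j => g i j z)⁻¹)ᵀ

/-- The Riemann curvature tensor
`R_{ij̄kl̄} = −∂_k∂_l̄ g_{ij̄} + g^{pq̄}(∂_l̄ g_{pj̄})(∂_k g_{iq̄})`. -/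
def Riem {n : ℕ} (g : Fin n → Fin n → EuclideanSpace ℂ (Fin n) → ℂ)
    (i j k l : Fin n) (z : EuclideanSpace ℂ (Fin n)) : ℂ :=
  - wd k (wdb l (g i j)) z
    + ∑ p, ∑ q, ginv g z p q * wdb l (g p j) z * wd k (g i q) z

/-- The functions `u_0 = 1`, `u_i = z^i` (`1 ≤ i ≤ n`), indexed by `Fin (n+1)`. -/
def uu {n : ℕ} (a : Fin (n + 1)) (z : EuclideanSpace ℂ (Fin n)) : ℂ :=
  if h : a = 0 then 1 else z (a.pred h)

/-- The matrix `H^{ab̄} = h u_a conj(u_b)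
  + h g^{pq̄}(∂_p u_a + u_a h⁻¹ ∂_p h) conj(∂_q u_b + u_b h⁻¹ ∂_q h)`. -/
def Hmat {n : ℕ} (h : EuclideanSpace ℂ (Fin n) → ℝ)
    (g : Fin n → Fin n → EuclideanSpace ℂ (Fin n) → ℂ)
    (a b : Fin (n + 1)) (z : EuclideanSpace ℂ (Fin n)) : ℂ :=
  (h z : ℂ) * uu a z * (starRingEnd ℂ) (uu b z)
    + (h z : ℂ) * ∑ p, ∑ q, ginv g z p q
        * (wd p (uu a) z + uu a z * (h z : ℂ)⁻¹ * wd p (fun w => (h w : ℂ)) z)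
        * (starRingEnd ℂ)
            (wd q (uu b) z + uu b z * (h z : ℂ)⁻¹ * wd q (fun w => (h w : ℂ)) z)


section helpers
open scoped ContDiff Topology
open Filter

abbrev En (n : ℕ) := EuclideanSpace ℂ (Fin n)

/-- common form of both Wirtinger derivatives -/
def DW {n : ℕ} (s : ℂ) (k : Fin n) (f : En n → ℂ) (z : En n) : ℂ :=
  (1/2 : ℂ) * (fderiv ℝ f z (EuclideanSpace.single k 1)
    + s * fderiv ℝ f z (EuclideanSpace.single k Complex.I))

lemma wd_eq {n : ℕ} (k : Fin n) : wd k = DW (-Complex.I) k := by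
  funext f z; simp only [wd, DW]; ring

lemma wdb_eq {n : ℕ} (k : Fin n) : wdb k = DW Complex.I k := rfl

/-- smooth germs at the origin -/
def Sm {n : ℕ} (f : En n → ℂ) : Prop := ContDiffAt ℝ ∞ f 0

lemma Sm.diff {n : ℕ} {f : En n → ℂ} (hf : Sm f) : DifferentiableAt ℝ f 0 :=
  ContDiffAt.differentiableAt hf (by simp)

lemma Sm.ev {n : ℕ} {f : En n → ℂ} (hf : Sm f) : ∀ᶠ z in 𝓝 (0 : En n), DifferentiableAt ℝ f z := by
  have h1 : ContDiffAt ℝ 1 f 0 := ContDiffAt.of_le hf (by exact_mod_cast le_top)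
  filter_upwards [h1.eventually (by simp)] with z hz
  exact hz.differentiableAt (by simp)

lemma Sm.congr {n : ℕ} {f g : En n → ℂ} (hf : Sm f) (h : g =ᶠ[𝓝 0] f) : Sm g :=
  ContDiffAt.congr_of_eventuallyEq hf h

lemma Sm.const {n : ℕ} (c : ℂ) : Sm (fun _ : En n => c) := contDiffAt_const

lemma Sm.mul {n : ℕ} {f g : En n → ℂ} (hf : Sm f) (hg : Sm g) : Sm (fun z => f z * g z) :=
  ContDiffAt.mul hf hg

lemma Sm.add {n : ℕ} {f g : En n → ℂ} (hf : Sm f) (hg : Sm g) : Sm (fun z => f z + g z) :=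
  ContDiffAt.add hf hg

lemma Sm.sum {n : ℕ} {ι : Type*} (s : Finset ι) {f : ι → En n → ℂ} (hf : ∀ i, Sm (f i)) :
    Sm (fun z => ∑ i ∈ s, f i z) :=
  ContDiffAt.sum fun i _ => hf i

lemma Sm.prod {n : ℕ} {ι : Type*} (s : Finset ι) {f : ι → En n → ℂ} (hf : ∀ i, Sm (f i)) :
    Sm (fun z => ∏ i ∈ s, f i z) :=
  contDiffAt_prod fun i _ => hf i

lemma Sm.conj {n : ℕ} {f : En n → ℂ} (hf : Sm f) : Sm (fun z => (starRingEnd ℂ) (f z)) :=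
  (Complex.conjCLE.contDiff.contDiffAt).comp (0 : En n) hf

lemma Sm.DW {n : ℕ} {f : En n → ℂ} (hf : Sm f) (s : ℂ) (k : Fin n) : Sm (DW s k f) := by
  have h1 : ContDiffAt ℝ ∞ (fderiv ℝ f) 0 := ContDiffAt.fderiv_right hf (by simp)
  unfold Sm _root_.DW
  exact contDiffAt_const.mul ((h1.clm_apply contDiffAt_const).add
    (contDiffAt_const.mul (h1.clm_apply contDiffAt_const)))

lemma DW_congr {n : ℕ} {f g : En n → ℂ} {z : En n} (s : ℂ) (k : Fin n) (h : f =ᶠ[𝓝 z] g) :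
    DW s k f z = DW s k g z := by
  simp only [DW, h.fderiv_eq]

lemma DW_congr_ev {n : ℕ} {f g : En n → ℂ} {z : En n} (s : ℂ) (k : Fin n) (h : f =ᶠ[𝓝 z] g) :
    DW s k f =ᶠ[𝓝 z] DW s k g := by
  filter_upwards [h.eventuallyEq_nhds] with w hw using DW_congr s k hw

lemma DW_const {n : ℕ} (s c : ℂ) (k : Fin n) (z : En n) : DW s k (fun _ => c) z = 0 := by
  simp [DW]

lemma DW_mul {n : ℕ} {f g : En n → ℂ} {z : En n} (s : ℂ) (k : Fin n)
    (hf : DifferentiableAt ℝ f z) (hg : DifferentiableAt ℝ g z) :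
    DW s k (fun w => f w * g w) z = DW s k f z * g z + f z * DW s k g z := by
  simp only [DW, fderiv_fun_mul hf hg]
  simp
  ring

lemma DW_add {n : ℕ} {f g : En n → ℂ} {z : En n} (s : ℂ) (k : Fin n)
    (hf : DifferentiableAt ℝ f z) (hg : DifferentiableAt ℝ g z) :
    DW s k (fun w => f w + g w) z = DW s k f z + DW s k g z := by
  simp only [DW, fderiv_fun_add hf hg]
  simp
  ring

lemma DW_sum {n : ℕ} {ι : Type*} (t : Finset ι) {f : ι → En n → ℂ} {z : En n} (s : ℂ) (k : Fin n)
    (hf : ∀ i, DifferentiableAt ℝ (f i) z) :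
    DW s k (fun w => ∑ i ∈ t, f i w) z = ∑ i ∈ t, DW s k (f i) z := by
  simp only [DW, fderiv_fun_sum (fun i _ => hf i)]
  simp [Finset.mul_sum, Finset.sum_add_distrib, mul_add]

lemma DW_conj {n : ℕ} (f : En n → ℂ) (z : En n) (s : ℂ) (k : Fin n) :
    DW s k (fun w => (starRingEnd ℂ) (f w)) z
      = (starRingEnd ℂ) (DW ((starRingEnd ℂ) s) k f z) := by
  have h : fderiv ℝ (fun w => (starRingEnd ℂ) (f w)) z
      = (Complex.conjCLE : ℂ →L[ℝ] ℂ).comp (fderiv ℝ f z) :=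
    Complex.conjCLE.comp_fderiv (f := f) (x := z)
  have h2 : (starRingEnd ℂ) (2 : ℂ) = 2 := Complex.conj_ofNat 2
  simp [DW, h, h2]

lemma DW_comm {n : ℕ} {f : En n → ℂ} (hf : Sm f) (s t : ℂ) (k l : Fin n) :
    DW s k (DW t l f) 0 = DW t l (DW s k f) 0 := by
  have h1 : ContDiffAt ℝ ∞ (fderiv ℝ f) 0 := ContDiffAt.fderiv_right hf (by simp)
  have hd : DifferentiableAt ℝ (fderiv ℝ f) 0 := h1.differentiableAt (by simp)
  have hsym : IsSymmSndFDerivAt ℝ f 0 :=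
    ContDiffAt.isSymmSndFDerivAt hf (by simp; exact WithTop.coe_le_coe.2 (le_top : (2 : ℕ∞) ≤ ⊤))
  have key : ∀ v w : En n, fderiv ℝ (fun z => fderiv ℝ f z v) 0 w
      = fderiv ℝ (fderiv ℝ f) 0 w v := by
    intro v w
    rw [fderiv_clm_apply hd (differentiableAt_const v)]
    simp
  have da : ∀ v : En n, DifferentiableAt ℝ (fun z => fderiv ℝ f z v) 0 := fun v =>
    hd.clm_apply (differentiableAt_const v)
  have e : ∀ (s t : ℂ) (k l : Fin n), DW s k (DW t l f) 0 = (1/4 : ℂ) *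
      (fderiv ℝ (fderiv ℝ f) 0 (EuclideanSpace.single k 1) (EuclideanSpace.single l 1)
      + t * fderiv ℝ (fderiv ℝ f) 0 (EuclideanSpace.single k 1) (EuclideanSpace.single l Complex.I)
      + s * fderiv ℝ (fderiv ℝ f) 0 (EuclideanSpace.single k Complex.I) (EuclideanSpace.single l 1)
      + s * t * fderiv ℝ (fderiv ℝ f) 0 (EuclideanSpace.single k Complex.I)
          (EuclideanSpace.single l Complex.I)) := by
    intro s t k l
    have hh : ∀ w : En n, fderiv ℝ (DW t l f) 0 w = (1/2 : ℂ) *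
      (fderiv ℝ (fderiv ℝ f) 0 w (EuclideanSpace.single l 1)
      + t * fderiv ℝ (fderiv ℝ f) 0 w (EuclideanSpace.single l Complex.I)) := by
      intro w
      have : fderiv ℝ (DW t l f) 0 = fderiv ℝ (fun z => (1/2 : ℂ) *
        (fderiv ℝ f z (EuclideanSpace.single l 1)
          + t * fderiv ℝ f z (EuclideanSpace.single l Complex.I))) 0 := rfl
      rw [this, fderiv_const_mul ((da _).fun_add ((da _).const_mul t)),
        fderiv_fun_add (da _) ((da _).const_mul t), fderiv_const_mul (da _)]
      simp [key]
      ring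
    rw [DW, hh, hh]; ring
  rw [e, e, hsym (EuclideanSpace.single k 1) (EuclideanSpace.single l 1),
    hsym (EuclideanSpace.single k 1) (EuclideanSpace.single l Complex.I),
    hsym (EuclideanSpace.single k Complex.I) (EuclideanSpace.single l 1),
    hsym (EuclideanSpace.single k Complex.I) (EuclideanSpace.single l Complex.I)]
  ring

lemma DW2_mul {n : ℕ} {f g : En n → ℂ} (hf : Sm f) (hg : Sm g) (s t : ℂ) (k l : Fin n) :
    DW s k (DW t l (fun w => f w * g w)) 0 =
      DW s k (DW t l f) 0 * g 0 + DW t l f 0 * DW s k g 0 + DW s k f 0 * DW t l g 0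
        + f 0 * DW s k (DW t l g) 0 := by
  have h : DW t l (fun w => f w * g w) =ᶠ[𝓝 0] fun z => DW t l f z * g z + f z * DW t l g z := by
    filter_upwards [hf.ev, hg.ev] with z h1 h2 using DW_mul t l h1 h2
  rw [DW_congr s k h, DW_add s k ((hf.DW t l).mul hg).diff (hf.mul (hg.DW t l)).diff,
    DW_mul s k (hf.DW t l).diff hg.diff, DW_mul s k hf.diff (hg.DW t l).diff]
  ring

lemma DW2_add {n : ℕ} {f g : En n → ℂ} (hf : Sm f) (hg : Sm g) (s t : ℂ) (k l : Fin n) :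
    DW s k (DW t l (fun w => f w + g w)) 0 =
      DW s k (DW t l f) 0 + DW s k (DW t l g) 0 := by
  have h : DW t l (fun w => f w + g w) =ᶠ[𝓝 0] fun z => DW t l f z + DW t l g z := by
    filter_upwards [hf.ev, hg.ev] with z h1 h2 using DW_add t l h1 h2
  rw [DW_congr s k h, DW_add s k (hf.DW t l).diff (hg.DW t l).diff]

lemma DW2_sum {n : ℕ} {ι : Type*} [Fintype ι] {f : ι → En n → ℂ} (hf : ∀ i, Sm (f i))
    (s t : ℂ) (k l : Fin n) :
    DW s k (DW t l (fun w => ∑ i, f i w)) 0 = ∑ i, DW s k (DW t l (f i)) 0 := by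
  have h : DW t l (fun w => ∑ i, f i w) =ᶠ[𝓝 0] fun z => ∑ i, DW t l (f i) z := by
    filter_upwards [eventually_all.2 fun i => (hf i).ev] with z h1 using DW_sum _ t l h1
  rw [DW_congr s k h, DW_sum _ s k fun i => ((hf i).DW t l).diff]

lemma DW2_conj {n : ℕ} {f : En n → ℂ} (hf : Sm f) (k l : Fin n) :
    DW (-Complex.I) k (DW Complex.I l (fun w => (starRingEnd ℂ) (f w))) 0
      = (starRingEnd ℂ) (DW (-Complex.I) l (DW Complex.I k f) 0) := by
  have h : DW Complex.I l (fun w => (starRingEnd ℂ) (f w))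
      = fun w => (starRingEnd ℂ) (DW (-Complex.I) l f w) := by
    funext w; rw [DW_conj]; simp
  rw [h, DW_conj, DW_comm hf]; simp

lemma DW_coord {n : ℕ} (s : ℂ) (k j : Fin n) (z : En n) :
    DW s k (fun w => w j) z = if k = j then (1/2 : ℂ) * (1 + s * Complex.I) else 0 := by
  have h : fderiv ℝ (fun w : En n => w j) z
      = (EuclideanSpace.proj j : En n →L[ℂ] ℂ).restrictScalars ℝ :=
    ((EuclideanSpace.proj j : En n →L[ℂ] ℂ).restrictScalars ℝ).fderiv
  simp only [DW, h]
  by_cases hk : k = j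
  · subst hk; simp
  · have : j ≠ k := fun h => hk h.symm
    simp [hk, this]

lemma Sm_coord {n : ℕ} (j : Fin n) : Sm (fun w : En n => w j) :=
  (((EuclideanSpace.proj j : En n →L[ℂ] ℂ).restrictScalars ℝ).contDiff).contDiffAt

lemma Sm_det {n : ℕ} {m : ℕ} {M : En n → Matrix (Fin m) (Fin m) ℂ}
    (hM : ∀ i j, Sm (fun z => M z i j)) : Sm (fun z => (M z).det) := by
  simp only [Matrix.det_apply', ]
  exact Sm.sum _ fun σ => (Sm.const _).mul (Sm.prod _ fun i => hM _ _)

lemma Sm_ginv {n : ℕ} {g : Fin n → Fin n → En n → ℂ} (hg : ∀ i j, Sm (g i j))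
    (h0 : (Matrix.of fun i j => g i j 0).det ≠ 0) (p q : Fin n) :
    Sm (fun z => ginv g z p q) := by
  simp only [ginv, Matrix.transpose_apply, Matrix.inv_def, Matrix.smul_apply,
    Matrix.adjugate_apply, Ring.inverse_eq_inv', smul_eq_mul]
  refine Sm.mul (ContDiffAt.inv (Sm_det fun i j => hg i j) h0) (Sm_det fun i j => ?_)
  by_cases hi : i = p
  · subst hi; simp only [Matrix.updateRow_self]; exact Sm.const _
  · simp only [Matrix.updateRow_ne hi]; exact hg i j

end helpers


section helpers2
open scoped ContDiff Topology
open Filter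

lemma DW_log {n : ℕ} {h : En n → ℝ} {z : En n} (hd : DifferentiableAt ℝ h z) (hz : h z ≠ 0)
    (s : ℂ) (k : Fin n) :
    DW s k (fun w => (h w : ℂ)) z = (h z : ℂ) * DW s k (fun w => (Real.log (h w) : ℂ)) z := by
  have h1 : HasFDerivAt (fun w => (h w : ℂ)) (Complex.ofRealCLM.comp (fderiv ℝ h z)) z :=
    (Complex.ofRealCLM.hasFDerivAt (x := h z)).comp z hd.hasFDerivAt
  have h2 : HasFDerivAt (fun w => (Real.log (h w) : ℂ))
      (Complex.ofRealCLM.comp ((h z)⁻¹ • fderiv ℝ h z)) z :=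
    (Complex.ofRealCLM.hasFDerivAt (x := Real.log (h z))).comp z (hd.hasFDerivAt.log hz)
  have hz' : (h z : ℂ) ≠ 0 := by exact_mod_cast hz
  simp only [DW, h1.fderiv, h2.fderiv]
  simp
  field_simp

lemma Sm_uu {n : ℕ} (a : Fin (n + 1)) : Sm (uu a : En n → ℂ) := by
  by_cases ha : a = 0
  · have : (uu a : En n → ℂ) = fun _ => 1 := by funext z; simp [uu, ha]
    rw [this]; exact Sm.const _
  · have : (uu a : En n → ℂ) = fun z => z (a.pred ha) := by funext z; simp [uu, ha]
    rw [this]; exact Sm_coord _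

/-- `U^a_p = ∂_p u_a + u_a ∂_p log h` -/
def UU {n : ℕ} (L : En n → ℂ) (a : Fin (n + 1)) (p : Fin n) (z : En n) : ℂ :=
  DW (-Complex.I) p (uu a) z + uu a z * DW (-Complex.I) p L z

lemma Sm_UU {n : ℕ} {L : En n → ℂ} (hL : Sm L) (a : Fin (n + 1)) (p : Fin n) : Sm (UU L a p) :=
  ((Sm_uu a).DW _ _).add ((Sm_uu a).mul (hL.DW _ _))

lemma uu_zero {n : ℕ} : (uu 0 : En n → ℂ) = fun _ => 1 := by funext z; simp [uu]

lemma uu_ne {n : ℕ} {a : Fin (n + 1)} (ha : a ≠ 0) :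
    (uu a : En n → ℂ) = fun z => z (a.pred ha) := by funext z; simp [uu, ha]

lemma UU_zero {n : ℕ} (L : En n → ℂ) (p : Fin n) : UU L 0 p = DW (-Complex.I) p L := by
  funext z; simp [UU, uu_zero, DW_const]

lemma DW_UU_ne {n : ℕ} {L : En n → ℂ} (hL : Sm L) (hL1 : ∀ s k, DW s k L 0 = 0)
    {a : Fin (n + 1)} (ha : a ≠ 0) (p : Fin n) (s : ℂ) (k : Fin n) :
    DW s k (UU L a p) 0 = 0 := by
  have : UU L a p = fun z => (if p = a.pred ha then (1/2 : ℂ) * (1 + (-Complex.I) * Complex.I) else 0)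
      + z (a.pred ha) * DW (-Complex.I) p L z := by
    funext z; simp only [UU, uu_ne ha, DW_coord]
  rw [this, DW_add s k (Sm.const _).diff ((Sm_coord _).mul (hL.DW _ _)).diff, DW_const,
    DW_mul s k (Sm_coord _).diff (hL.DW _ _).diff, hL1]
  simp

/-- The core computation at the origin. -/
lemma core {n : ℕ} {L hc : En n → ℂ} {γ : Fin n → Fin n → En n → ℂ}
    (hL : Sm L) (hhc : Sm hc) (hγ : ∀ p q, Sm (γ p q))
    (hc0 : hc 0 = 1) (hc1 : ∀ s k, DW s k hc 0 = 0)
    (hc2 : ∀ k l, DW (-Complex.I) k (DW Complex.I l hc) 0 = - if k = l then 1 else 0)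
    (γ0 : ∀ p q, γ p q 0 = if p = q then 1 else 0)
    (γ1 : ∀ p q s k, (s = Complex.I ∨ s = -Complex.I) → DW s k (γ p q) 0 = 0)
    (hL1 : ∀ s k, DW s k L 0 = 0)
    (hL20 : ∀ p k, DW (-Complex.I) k (DW (-Complex.I) p L) 0 = 0)
    (hL2 : ∀ p l, DW Complex.I l (DW (-Complex.I) p L) 0 = - if p = l then 1 else 0)
    (hL3 : ∀ p k l, DW (-Complex.I) k (DW Complex.I l (DW (-Complex.I) p L)) 0 = 0)
    (a b : Fin (n + 1)) (hab : a = 0 ∨ b = 0) (k l : Fin n) :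
    DW (-Complex.I) k (DW Complex.I l (fun z => hc z * (uu a z * (starRingEnd ℂ) (uu b z))
      + ∑ p, ∑ q, (hc z * γ p q z) * (UU L a p z * (starRingEnd ℂ) (UU L b q z)))) 0 = 0 := by
  have sW : Sm (fun z : En n => uu a z * (starRingEnd ℂ) (uu b z)) := (Sm_uu a).mul (Sm_uu b).conj
  have sT : ∀ p q, Sm (fun z => hc z * γ p q z) := fun p q => hhc.mul (hγ p q)
  have sV : ∀ q, Sm (fun z => (starRingEnd ℂ) (UU L b q z)) := fun q => (Sm_UU hL b q).conj
  have sUV : ∀ p q, Sm (fun z => UU L a p z * (starRingEnd ℂ) (UU L b q z)) := fun p q =>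
    (Sm_UU hL a p).mul (sV q)
  have T1 : ∀ p q s k, (s = Complex.I ∨ s = -Complex.I) →
      DW s k (fun z => hc z * γ p q z) 0 = 0 := by
    intro p q s k hs
    rw [DW_mul s k hhc.diff (hγ p q).diff, hc1, γ1 p q s k hs]; simp
  have UV0 : ∀ p q, UU L a p 0 * (starRingEnd ℂ) (UU L b q 0) = 0 := by
    intro p q
    rcases hab with rfl | rfl <;> simp [UU_zero, hL1]
  rw [DW2_add (hhc.mul sW) (Sm.sum _ fun p => Sm.sum _ fun q => (sT p q).mul (sUV p q)),
    DW2_sum (fun p => Sm.sum _ fun q => (sT p q).mul (sUV p q)), DW2_mul hhc sW]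
  have e : ∀ p q, DW (-Complex.I) k (DW Complex.I l (fun z => (hc z * γ p q z) *
      (UU L a p z * (starRingEnd ℂ) (UU L b q z)))) 0 = if p = q then
        (DW (-Complex.I) k (DW Complex.I l (UU L a p)) 0 * (starRingEnd ℂ) (UU L b p 0)
        + DW Complex.I l (UU L a p) 0 * (starRingEnd ℂ) (DW Complex.I k (UU L b p) 0)
        + DW (-Complex.I) k (UU L a p) 0 * (starRingEnd ℂ) (DW (-Complex.I) l (UU L b p) 0)
        + UU L a p 0 * (starRingEnd ℂ) (DW (-Complex.I) l (DW Complex.I k (UU L b p)) 0)) else 0 := by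
    intro p q
    rw [DW2_mul (sT p q) (sUV p q), T1 p q _ _ (Or.inl rfl), T1 p q _ _ (Or.inr rfl), UV0,
      DW2_mul (Sm_UU hL a p) (sV q), DW2_conj (Sm_UU hL b q), DW_conj, DW_conj, hc0, γ0]
    by_cases hpq : p = q
    · subst hpq; simp
    · simp [hpq]
  have e2 : ∀ p, DW (-Complex.I) k (DW Complex.I l (fun z => ∑ q, (hc z * γ p q z) *
      (UU L a p z * (starRingEnd ℂ) (UU L b q z)))) 0 =
        (DW (-Complex.I) k (DW Complex.I l (UU L a p)) 0 * (starRingEnd ℂ) (UU L b p 0)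
        + DW Complex.I l (UU L a p) 0 * (starRingEnd ℂ) (DW Complex.I k (UU L b p) 0)
        + DW (-Complex.I) k (UU L a p) 0 * (starRingEnd ℂ) (DW (-Complex.I) l (UU L b p) 0)
        + UU L a p 0 * (starRingEnd ℂ) (DW (-Complex.I) l (DW Complex.I k (UU L b p)) 0)) := by
    intro p
    rw [DW2_sum fun q => (sT p q).mul (sUV p q)]
    simp only [e]
    simp
  rw [Finset.sum_congr rfl fun p _ => e2 p, hc1, hc1, hc2, hc0,
    DW2_mul (Sm_uu a) (Sm_uu b).conj, DW2_conj (Sm_uu b), DW_conj, DW_conj]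
  have c2 : ∀ k l : Fin n, DW (-Complex.I) k (DW Complex.I l (fun _ : En n => (1 : ℂ))) 0 = 0 := by
    intro k l
    have : DW Complex.I l (fun _ : En n => (1 : ℂ)) = fun _ => 0 := by funext z; exact DW_const _ _ _ _
    rw [this, DW_const]
  have z2 : ∀ k l j : Fin n, DW (-Complex.I) k (DW Complex.I l (fun w : En n => w j)) 0 = 0 := by
    intro k l j
    have : DW Complex.I l (fun w : En n => w j) = fun _ => 0 := by funext z; simp [DW_coord]
    rw [this, DW_const]
  by_cases ha : a = 0
  · subst ha
    by_cases hb : b = 0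
    · subst hb
      simp only [UU_zero, hL1, hL20, hL2, hL3, uu_zero, c2, DW_const]
      by_cases hkl : k = l
      · simp [hkl]
      · simp [hkl]
    · simp only [UU_zero, hL1, hL20, hL2, hL3, uu_zero, c2, DW_const, DW_UU_ne hL hL1 hb, uu_ne hb, z2]
      simp
  · have hb : b = 0 := hab.resolve_left ha
    subst hb
    simp only [UU_zero, hL1, hL20, hL2, hL3, uu_zero, c2, DW_const, DW_UU_ne hL hL1 ha, uu_ne ha, z2]
    simp

end helpers2

/-- In the normalized local setup at the origin,
`(∂_k ∂_l̄ H^{ab̄})(0) = 0` whenever `a = 0` or `b = 0`. -/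
theorem ddbarHmat_row_zero_at_origin
    (n : ℕ) (Ω : Set (EuclideanSpace ℂ (Fin n)))
    (hΩ : IsOpen Ω) (h0Ω : (0 : EuclideanSpace ℂ (Fin n)) ∈ Ω)
    -- `g_{ij̄} = ∂_i∂_j̄ φ` is positive definite on the neighborhood `Ω` of `0`:
    (φ : EuclideanSpace ℂ (Fin n) → ℝ) (hφ : ContDiffOn ℝ (⊤ : ℕ∞) φ Ω)
    (g : Fin n → Fin n → EuclideanSpace ℂ (Fin n) → ℂ)
    (hgφ : ∀ i j : Fin n, ∀ z ∈ Ω, g i j z = wd i (wdb j (fun w => (φ w : ℂ))) z)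
    (hposdef : ∀ z ∈ Ω, (Matrix.of fun i j => g i j z).PosDef)
    -- normalization of `g` at the origin:
    (hg0 : ∀ i j : Fin n, g i j 0 = if i = j then 1 else 0)
    (hdg0 : ∀ i j k : Fin n, wd k (g i j) 0 = 0 ∧ wdb k (g i j) 0 = 0)
    -- `h` is a smooth positive function with `g = −∂∂̄ log h`, normalized at the origin:
    (h : EuclideanSpace ℂ (Fin n) → ℝ) (hsm : ContDiffOn ℝ (⊤ : ℕ∞) h Ω)
    (hpos : ∀ z ∈ Ω, 0 < h z)
    (hgh : ∀ i j : Fin n, ∀ z ∈ Ω,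
      g i j z = -wd i (wdb j (fun w => (Real.log (h w) : ℂ))) z)
    (hh0 : h 0 = 1) (hdh0 : fderiv ℝ h 0 = 0)
    (hh2 : ∀ i j : Fin n, wd i (wd j (fun w => (h w : ℂ))) 0 = 0
      ∧ wdb i (wdb j (fun w => (h w : ℂ))) 0 = 0)
    :
    ∀ a b : Fin (n + 1), (a = 0 ∨ b = 0) →
      ∀ k l : Fin n, wd k (wdb l (Hmat h g a b)) 0 = 0 := by
  intro a b hab k l
  have hΩn : Ω ∈ nhds (0 : En n) := hΩ.mem_nhds h0Ω
  have hh : ContDiffAt ℝ (⊤ : ℕ∞) h 0 := hsm.contDiffAt hΩn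
  have hhc : Sm (fun w => (h w : ℂ)) := (Complex.ofRealCLM.contDiff.contDiffAt).comp (0 : En n) hh
  have hL : Sm (fun w => (Real.log (h w) : ℂ)) :=
    (Complex.ofRealCLM.contDiff.contDiffAt).comp (0 : En n) (hh.log (by simp [hh0]))
  simp only [wd_eq, wdb_eq] at hgh hdg0 hh2 ⊢
  -- the derivatives of `h` in terms of those of `log h`
  have hlog : ∀ s k, ∀ z ∈ Ω, DW s k (fun w => (h w : ℂ)) z
      = (h z : ℂ) * DW s k (fun w => (Real.log (h w) : ℂ)) z := fun s k z hz =>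
    DW_log ((hsm.contDiffAt (hΩ.mem_nhds hz)).differentiableAt (by simp)) (hpos z hz).ne' s k
  have hlogev : ∀ s k, DW s k (fun w => (h w : ℂ)) =ᶠ[nhds 0]
      fun z => (h z : ℂ) * DW s k (fun w => (Real.log (h w) : ℂ)) z := fun s k =>
    Filter.eventually_of_mem hΩn (hlog s k)
  have hc1 : ∀ s k, DW s k (fun w => (h w : ℂ)) (0 : En n) = 0 := by
    intro s k
    have h1 : HasFDerivAt (fun w => (h w : ℂ)) (Complex.ofRealCLM.comp (fderiv ℝ h 0)) 0 :=
      (Complex.ofRealCLM.hasFDerivAt (x := h 0)).comp (0 : En n)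
        (hh.differentiableAt (by simp)).hasFDerivAt
    simp [DW, h1.fderiv, hdh0]
  have hL1 : ∀ s k, DW s k (fun w => (Real.log (h w) : ℂ)) (0 : En n) = 0 := by
    intro s k
    have := hlog s k 0 h0Ω
    rw [hc1, hh0] at this
    simpa using this.symm
  have hD2 : ∀ s t k l, DW s k (DW t l (fun w => (h w : ℂ))) (0 : En n)
      = DW s k (DW t l (fun w => (Real.log (h w) : ℂ))) 0 := by
    intro s t k l
    rw [DW_congr s k (hlogev t l), DW_mul s k hhc.diff (hL.DW t l).diff, hc1, hh0]
    simp
  have hgev : ∀ i j, g i j =ᶠ[nhds 0]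
      fun z => (-1 : ℂ) * DW (-Complex.I) i (DW Complex.I j (fun w => (Real.log (h w) : ℂ))) z :=
    fun i j => Filter.eventually_of_mem hΩn fun z hz => by
      rw [hgh i j z hz]; ring
  have hg : ∀ i j, Sm (g i j) := fun i j =>
    ((Sm.const (-1)).mul ((hL.DW _ _).DW _ _)).congr (hgev i j)
  have hD2g : ∀ i j, DW (-Complex.I) i (DW Complex.I j (fun w => (Real.log (h w) : ℂ))) (0 : En n)
      = - if i = j then 1 else 0 := by
    intro i j
    rw [← hg0 i j, hgh i j 0 h0Ω]; ring
  have hgD : ∀ s k i j, DW s k (g i j) 0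
      = - DW s k (DW (-Complex.I) i (DW Complex.I j (fun w => (Real.log (h w) : ℂ)))) 0 := by
    intro s k i j
    rw [DW_congr s k (hgev i j), DW_mul s k (Sm.const _).diff ((hL.DW _ _).DW _ _).diff, DW_const]
    ring
  have hdet : ∀ z ∈ Ω, (Matrix.of fun i j => g i j z).det ≠ 0 := fun z hz =>
    ((Matrix.isUnit_iff_isUnit_det _).1 (hposdef z hz).isUnit).ne_zero
  have hγ : ∀ p q, Sm (fun z => ginv g z p q) := Sm_ginv hg (hdet 0 h0Ω)
  have hid : ∀ p r, ∀ z ∈ Ω, ∑ q, ginv g z p q * g r q z = if r = p then 1 else 0 := by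
    intro p r z hz
    have := congrFun (congrFun (Matrix.mul_nonsing_inv (Matrix.of fun i j => g i j z)
      (hdet z hz).isUnit) r) p
    rw [Matrix.mul_apply, Matrix.one_apply] at this
    rw [← this]
    refine Finset.sum_congr rfl fun q _ => ?_
    simp [ginv, mul_comm]
  have γ0 : ∀ p q, ginv g 0 p q = if p = q then 1 else 0 := by
    intro p q
    have := hid p q 0 h0Ω
    simp only [hg0] at this
    simp at this
    rw [this]; simp [eq_comm]
  have γ1 : ∀ p q s k, (s = Complex.I ∨ s = -Complex.I) →
      DW s k (fun z => ginv g z p q) 0 = 0 := by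
    intro p r s k hs
    have hg1 : ∀ i j, DW s k (g i j) 0 = 0 := by
      intro i j
      rcases hs with rfl | rfl
      · exact (hdg0 i j k).2
      · exact (hdg0 i j k).1
    have h1 : DW s k (fun z => ∑ q, ginv g z p q * g r q z) 0 = 0 := by
      rw [DW_congr s k (Filter.eventually_of_mem hΩn (hid p r)), DW_const]
    rw [DW_sum _ s k fun q => ((hγ p q).mul (hg r q)).diff] at h1
    simp only [DW_mul s k (hγ p _).diff (hg r _).diff, hg1, hg0] at h1
    simpa using h1
  have key := core (γ := fun p q z => ginv g z p q) hL hhc hγ (by simp [hh0]) hc1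
    (fun k l => by rw [hD2, hD2g]) γ0 γ1 hL1
    (fun p k => by rw [← hD2]; exact (hh2 k p).1)
    (fun p l => by rw [DW_comm hL, hD2g])
    (fun p k l => by
      have c1 : DW (-Complex.I) p (fun w : En n => (Real.log (h w) : ℂ)) = fun z =>
          (starRingEnd ℂ) (DW Complex.I p (fun w => (Real.log (h w) : ℂ)) z) := by
        funext z
        have := DW_conj (fun w : En n => (Real.log (h w) : ℂ)) z (-Complex.I) p
        simpa only [Complex.conj_ofReal, map_neg, Complex.conj_I, neg_neg] using this
      have c2 : DW Complex.I l (DW (-Complex.I) p (fun w : En n => (Real.log (h w) : ℂ))) = fun z =>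
          (starRingEnd ℂ) (DW (-Complex.I) l (DW Complex.I p (fun w => (Real.log (h w) : ℂ))) z) := by
        funext z
        rw [c1, DW_conj, Complex.conj_I]
      have hx := hgD Complex.I k l p
      rw [(hdg0 l p k).2] at hx
      rw [c2, DW_conj, map_neg, Complex.conj_I, neg_neg, neg_eq_zero.1 hx.symm, map_zero]) a b hab k l
  rw [← key]
  refine DW_congr _ _ (DW_congr_ev _ _ (Filter.eventually_of_mem hΩn fun z hz => ?_))
  have hz' : (h z : ℂ) ≠ 0 := by exact_mod_cast (hpos z hz).ne'
  simp only [Hmat, wd_eq, UU, hlog _ _ z hz, Finset.mul_sum]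
  congr 1
  · ring
  · refine Finset.sum_congr rfl fun p _ => Finset.sum_congr rfl fun q _ => ?_
    simp only [← mul_assoc, inv_mul_cancel_right₀ hz']
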